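/- Suppose J : [1/2, 1] → [0, ∞) is a function, and constants A, B, K, n > 0 and γ ∈ (0,1) satisfy: for all t ∈ [1/2,1], A·J(t)^γ - B ≤ n(1-t)·K·(J(t)+1). Suppose moreover that the function t ↦ nK(1-t)J(t)^{1-γ} is either always < A/2 on [1/2,1], or attains the value A/2 at some t' ∈ [1/2,1]. Then there exist constants C, c > 0 depending only on A, B, K, n, γ such that for some t ∈ [1/2,1] with 1-t ≥ c, we have J(t) ≤ C. -/

import Mathlib

/-- If `A x ^ γ - B ≤ D (x + 1)` and the coefficient satisfies `D x ^ (1 - γ) ≤ A / 2`, then `x`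
is bounded in terms of `A`, `B`, `γ` and any upper bound `M` for `D`. -/
theorem le_rpow_of_mul_rpow_sub_le {A B D M γ x : ℝ} (hA : 0 < A) (hγ0 : 0 < γ) (hγ1 : γ < 1)
    (hx : 0 ≤ x) (hDM : D ≤ M) (h : A * x ^ γ - B ≤ D * (x + 1))
    (hD : D * x ^ (1 - γ) ≤ A / 2) : x ≤ (2 * (M + B) / A) ^ γ⁻¹ := by
  have hsplit : x ^ γ * x ^ (1 - γ) = x := by
    rw [← Real.rpow_add_of_nonneg hx hγ0.le (by linarith), add_sub_cancel, Real.rpow_one]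
  have hpow : 0 ≤ x ^ γ := Real.rpow_nonneg hx γ
  have hbound : x ^ γ ≤ 2 * (M + B) / A := by
    have hDx : D * x ≤ x ^ γ * (A / 2) := by
      calc D * x = x ^ γ * (D * x ^ (1 - γ)) := by rw [mul_left_comm, hsplit]
        _ ≤ x ^ γ * (A / 2) := by gcongr
    rw [le_div_iff₀ hA]
    linarith
  exact (Real.le_rpow_inv_iff_of_pos hx (hpow.trans hbound) hγ0).2 hbound

/-- Abstract Step 2 argument: if `A·J(t)^γ - B ≤ n(1-t)K(J(t)+1)` on `[1/2,1]` and
the function `t ↦ nK(1-t)J(t)^{1-γ}` either stays below `A/2` or attains `A/2`,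
then there are constants `C, c > 0` depending only on `A, B, K, n, γ` such that
`J(t) ≤ C` for some `t` with `1 - t ≥ c`. -/
theorem stmt6 (A B K n γ : ℝ) (hA : 0 < A) (hB : 0 < B) (hK : 0 < K) (hn : 0 < n)
    (hγ0 : 0 < γ) (hγ1 : γ < 1) :
    ∃ C c : ℝ, 0 < C ∧ 0 < c ∧
      ∀ J : ℝ → ℝ, (∀ t ∈ Set.Icc (1 / 2 : ℝ) 1, 0 ≤ J t) →
        (∀ t ∈ Set.Icc (1 / 2 : ℝ) 1, A * J t ^ γ - B ≤ n * (1 - t) * K * (J t + 1)) →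
        ((∀ t ∈ Set.Icc (1 / 2 : ℝ) 1, n * K * (1 - t) * J t ^ (1 - γ) < A / 2) ∨
          (∃ t' ∈ Set.Icc (1 / 2 : ℝ) 1, n * K * (1 - t') * J t' ^ (1 - γ) = A / 2)) →
        ∃ t ∈ Set.Icc (1 / 2 : ℝ) 1, c ≤ 1 - t ∧ J t ≤ C := by
  set C := (2 * (n * K + B) / A) ^ γ⁻¹
  have hC : 0 < C := by positivity
  have hnK : 0 < n * K := mul_pos hn hK
  refine ⟨C, min (1 / 2) (A / 2 / (n * K * C ^ (1 - γ))), hC, by positivity, ?_⟩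
  intro J hJ hineq hcases
  have key : ∀ t ∈ Set.Icc (1 / 2 : ℝ) 1, n * K * (1 - t) * J t ^ (1 - γ) ≤ A / 2 → J t ≤ C := by
    intro t ht hle
    refine le_rpow_of_mul_rpow_sub_le hA hγ0 hγ1 (hJ t ht) ?_ ?_ hle
    · exact mul_le_of_le_one_right hnK.le (by linarith [ht.1])
    · rw [mul_right_comm n K]
      exact hineq t ht
  rcases hcases with hlt | ⟨t, ht, heq⟩
  · have hhalf : (1 / 2 : ℝ) ∈ Set.Icc (1 / 2 : ℝ) 1 := by norm_num
    exact ⟨1 / 2, hhalf, (min_le_left _ _).trans (by norm_num), key _ hhalf (hlt _ hhalf).le⟩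
  · have hJC := key t ht heq.le
    refine ⟨t, ht, (min_le_right _ _).trans ?_, hJC⟩
    rw [div_le_iff₀ (by positivity), ← heq]
    have hpow : J t ^ (1 - γ) ≤ C ^ (1 - γ) :=
      Real.rpow_le_rpow (hJ t ht) hJC (by linarith)
    have ht1 : 0 ≤ 1 - t := by linarith [ht.2]
    calc n * K * (1 - t) * J t ^ (1 - γ) ≤ n * K * (1 - t) * C ^ (1 - γ) := by gcongr
      _ = (1 - t) * (n * K * C ^ (1 - γ)) := by ring
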